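/- Suppose Σ_n r_n = +∞, Σ_n r_n² < +∞ and ρ(1 − α) < 1. Then for every i ∈ {1,…,N}, Z_n(i) − Z_n → 0 almost surely (synchronization); in particular, if Z_n converges almost surely to a random variable Z, then Z_n(i) → Z almost surely for every i. -/

import Mathlib

open MeasureTheory Filter Real

noncomputable section

/-- The σ-field `F_n = σ(Z_k(i) : 1 ≤ i ≤ N, 0 ≤ k ≤ n)` generated by the walks up to time `n`. -/
def walkFiltration {Ω : Type*} [MeasurableSpace Ω] {N : ℕ}
    (Z : ℕ → Fin N → Ω → ℝ) (n : ℕ) : MeasurableSpace Ω :=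
  ⨆ k ∈ Finset.range (n + 1), ⨆ i : Fin N, MeasurableSpace.comap (Z k i) (borel ℝ)

/-- The empirical mean `Z_n = N⁻¹ Σ_{i=1}^N Z_n(i)`. -/
def walkMean {Ω : Type*} {N : ℕ} (Z : ℕ → Fin N → Ω → ℝ) (n : ℕ) (ω : Ω) : ℝ :=
  (∑ i : Fin N, Z n i ω) / N

lemma walk_le {Ω : Type*} [m : MeasurableSpace Ω] {N : ℕ}
    (Z : ℕ → Fin N → Ω → ℝ) (hZ : ∀ n i, Measurable (Z n i)) (n : ℕ) :
    walkFiltration Z n ≤ m := by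
  unfold walkFiltration
  refine iSup₂_le fun k _ => iSup_le fun i => ?_
  rw [← BorelSpace.measurable_eq (α := ℝ)]
  exact (hZ k i).comap_le

lemma walk_mono {Ω : Type*} [m : MeasurableSpace Ω] {N : ℕ}
    (Z : ℕ → Fin N → Ω → ℝ) : Monotone (walkFiltration Z) := by
  intro a b hab
  unfold walkFiltration
  refine iSup₂_le fun k hk => ?_
  exact le_iSup₂_of_le k (by simp at hk ⊢; omega) le_rfl

lemma walk_meas {Ω : Type*} [m : MeasurableSpace Ω] {N : ℕ}
    (Z : ℕ → Fin N → Ω → ℝ) (n : ℕ) (i : Fin N) :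
    Measurable[walkFiltration Z n] (Z n i) := by
  rw [measurable_iff_comap_le]
  unfold walkFiltration
  rw [BorelSpace.measurable_eq (α := ℝ)]
  exact le_iSup₂_of_le n (by simp) (le_iSup_of_le i le_rfl)

def walkFilt {Ω : Type*} [m : MeasurableSpace Ω] {N : ℕ}
    (Z : ℕ → Fin N → Ω → ℝ) (hZ : ∀ n i, Measurable (Z n i)) : Filtration ℕ m where
  seq := walkFiltration Z
  mono' := walk_mono Z
  le' := walk_le Z hZ

lemma mean_mem {N : ℕ} (hN : 1 ≤ N) (f : Fin N → ℝ) (hf : ∀ i, f i ∈ Set.Icc (0:ℝ) 1) :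
    (∑ i, f i) / N ∈ Set.Icc (0:ℝ) 1 := by
  have hN' : (0:ℝ) < N := by exact_mod_cast hN
  constructor
  · exact div_nonneg (Finset.sum_nonneg fun i _ => (hf i).1) hN'.le
  · rw [div_le_one hN']
    calc ∑ i, f i ≤ ∑ _i : Fin N, (1:ℝ) := Finset.sum_le_sum fun i _ => (hf i).2
      _ = N := by simp

/-- Abstract one-dimensional stochastic approximation lemma. -/
lemma core {Ω : Type*} [m : MeasurableSpace Ω] (μ : Measure Ω) [IsProbabilityMeasure μ]
    (F : Filtration ℕ m) (D J : ℕ → Ω → ℝ) (ρ β : ℝ) (hρ : ρ ∈ Set.Icc (0:ℝ) 1)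
    (hβ : ρ * β < 1) (r : ℕ → ℝ) (hr : ∀ n, 0 ≤ r n ∧ r n < 1)
    (hD : ∀ n, Measurable[F n] (D n)) (hJ : ∀ n, Measurable (J n))
    (hD1 : ∀ n ω, |D n ω| ≤ 1) (hJ1 : ∀ n ω, |J n ω| ≤ 1)
    (hdyn : ∀ n ω, D (n+1) ω = (1 - r n) * D n ω + r n * (ρ * J n ω))
    (hcond : ∀ n, μ[J n | F n] =ᵐ[μ] fun ω => β * D n ω)
    (hrdiv : ¬ Summable r) (hrsq : Summable (fun n => (r n) ^ 2)) :
    ∀ᵐ ω ∂μ, Tendsto (fun n => D n ω) atTop (nhds 0) := by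
  obtain ⟨hρ0, hρ1⟩ := hρ
  set S : ℕ → ℝ := fun n => ∑ k ∈ Finset.range n, (r k)^2 with hS
  set T : ℝ := ∑' k, (r k)^2 with hT
  have hSlim : Tendsto S atTop (nhds T) := hrsq.hasSum.tendsto_sum_nat
  have hS0 : ∀ n, 0 ≤ S n := fun n => Finset.sum_nonneg fun _ _ => sq_nonneg _
  have hST : ∀ n, S n ≤ T := fun n => hrsq.sum_le_tsum _ fun _ _ => sq_nonneg _
  have hDm : ∀ n, Measurable (D n) := fun n => (hD n).mono (F.le n) le_rfl
  have hDsq : ∀ n ω, (D n ω)^2 ≤ 1 := fun n ω => by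
    rw [sq_le_one_iff_abs_le_one]; exact hD1 n ω
  set f : ℕ → Ω → ℝ := fun n ω => 4 * S n - (D n ω)^2 with hf
  have hfm : ∀ n, Measurable[F n] (f n) := fun n => by
    exact Measurable.sub measurable_const ((hD n).pow_const 2)
  have hfm' : ∀ n, Measurable (f n) := fun n => (hfm n).mono (F.le n) le_rfl
  have hT0 : 0 ≤ T := (hS0 0).trans (hST 0)
  have hfb : ∀ n ω, ‖f n ω‖ ≤ 4 * T + 1 := fun n ω => by
    rw [Real.norm_eq_abs, abs_le]
    have := hDsq n ω; have := hS0 n; have := hST n; have := sq_nonneg (D n ω)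
    constructor <;> simp only [hf] <;> linarith
  have bint : ∀ (g : Ω → ℝ) (C : ℝ), Measurable g → (∀ ω, ‖g ω‖ ≤ C) → Integrable g μ :=
    fun g C hg hb => Integrable.of_bound hg.aestronglyMeasurable C (ae_of_all _ hb)
  have hfi : ∀ n, Integrable (f n) μ := fun n => bint _ _ (hfm' n) (hfb n)
  have hDi : ∀ n, Integrable (fun ω => (D n ω)^2) μ := fun n =>
    bint _ 1 ((hDm n).pow_const 2) fun ω => by
      rw [Real.norm_eq_abs, abs_of_nonneg (sq_nonneg _)]; exact hDsq n ω
  have hJi : ∀ n, Integrable (J n) μ := fun n => bint _ 1 (hJ n) (hJ1 n)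
  have key : ∀ n, (fun ω => f n ω + 2 * (1 - ρ * β) * r n * (D n ω)^2)
      ≤ᵐ[μ] μ[f (n+1) | F n] := by
    intro n
    have hAm : Measurable[F n] (fun ω => f n ω + 2 * r n * (D n ω)^2) :=
      (hfm n).add (((hD n).pow_const 2).const_mul _)
    have hBm : Measurable[F n] (fun ω => (-2 * r n * ρ) * D n ω) := (hD n).const_mul _
    have hAi : Integrable (fun ω => f n ω + 2 * r n * (D n ω)^2) μ :=
      (hfi n).add ((hDi n).const_mul _)
    have hBJ : Integrable ((fun ω => (-2 * r n * ρ) * D n ω) * J n) μ := by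
      refine Integrable.bdd_mul (c := |-2 * r n * ρ|) (hJi n)
        ((hDm n).const_mul _).aestronglyMeasurable (ae_of_all _ fun ω => ?_)
      rw [Real.norm_eq_abs, abs_mul]
      exact mul_le_of_le_one_right (abs_nonneg _) (hD1 n ω)
    have h1 : ((fun ω => f n ω + 2 * r n * (D n ω)^2) +
        (fun ω => (-2 * r n * ρ) * D n ω) * J n) ≤ᵐ[μ] f (n+1) := by
      refine ae_of_all _ fun ω => ?_
      simp only [Pi.add_apply, Pi.mul_apply, hf, hS, Finset.sum_range_succ, hdyn]
      have hd := abs_le.1 (hD1 n ω)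
      have hj := abs_le.1 (hJ1 n ω)
      have hρj : |ρ * J n ω| ≤ 1 := by
        rw [abs_mul, abs_of_nonneg hρ0]
        exact mul_le_one₀ hρ1 (abs_nonneg _) (hJ1 n ω)
      have hρj' := abs_le.1 hρj
      have : (ρ * J n ω - D n ω)^2 ≤ 4 := by nlinarith
      nlinarith [mul_le_mul_of_nonneg_left this (sq_nonneg (r n))]
    have h2 := condExp_mono (m := F n) (hAi.add hBJ) (hfi (n+1)) h1
    have h3 := condExp_add hAi hBJ (F n)
    have h4 := condExp_mul_of_stronglyMeasurable_left (μ := μ) hBm.stronglyMeasurable hBJ (hJi n)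
    have h5 := condExp_of_stronglyMeasurable (μ := μ) (F.le n) hAm.stronglyMeasurable hAi
    filter_upwards [h2, h3, h4, hcond n] with ω h2 h3 h4 h6
    refine le_trans (le_of_eq ?_) h2
    rw [h3, Pi.add_apply, h4, h5, Pi.mul_apply, h6]
    ring
  have hsub : Submartingale f F μ := by
    refine submartingale_nat (fun n => (hfm n).stronglyMeasurable) hfi fun n => ?_
    filter_upwards [key n] with ω h
    refine le_trans ?_ h
    have : 0 ≤ 2 * (1 - ρ * β) * r n * (D n ω)^2 := by
      have := (hr n).1
      have : 0 ≤ 1 - ρ * β := by linarith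
      positivity
    linarith
  have hconv := hsub.exists_ae_tendsto_of_bdd (R := (4 * T + 1).toNNReal) (fun n => by
    refine (eLpNorm_le_of_ae_bound (ae_of_all _ (hfb n))).trans ?_
    simp [ENNReal.ofReal])
  set L : Ω → ℝ := fun ω => 4 * T - limUnder atTop (fun n => f n ω) with hL
  have hDL : ∀ᵐ ω ∂μ, Tendsto (fun n => (D n ω)^2) atTop (nhds (L ω)) := by
    filter_upwards [hconv] with ω h
    have := (hSlim.const_mul 4).sub (tendsto_nhds_limUnder h)
    simpa [hf] using this
  have hint : Tendsto (fun n => ∫ ω, (D n ω)^2 ∂μ) atTop (nhds (∫ ω, L ω ∂μ)) := by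
    refine tendsto_integral_of_dominated_convergence (fun _ => (1:ℝ))
      (fun n => (hDi n).aestronglyMeasurable) (integrable_const _)
      (fun n => ae_of_all _ fun ω => ?_) hDL
    rw [Real.norm_eq_abs, abs_of_nonneg (sq_nonneg _)]; exact hDsq n ω
  have hL0 : ∀ᵐ ω ∂μ, 0 ≤ L ω := by
    filter_upwards [hDL] with ω h
    exact ge_of_tendsto' h fun n => sq_nonneg _
  have hLi : Integrable L μ := by
    refine Integrable.of_bound (C := 1)
      (aestronglyMeasurable_of_tendsto_ae atTop (fun n => (hDi n).aestronglyMeasurable) hDL) ?_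
    filter_upwards [hDL, hL0] with ω h h0
    rw [Real.norm_eq_abs, abs_of_nonneg h0]
    exact le_of_tendsto' h fun n => hDsq n ω
  have hx0 : ∀ n, 0 ≤ ∫ ω, (D n ω)^2 ∂μ := fun n => integral_nonneg fun _ => sq_nonneg _
  have hstep : ∀ n, ∫ ω, f n ω ∂μ + 2 * (1 - ρ * β) * (r n * ∫ ω, (D n ω)^2 ∂μ)
      ≤ ∫ ω, f (n+1) ω ∂μ := by
    intro n
    have := integral_mono_ae ((hfi n).add ((hDi n).const_mul _)) integrable_condExp (key n)
    rw [integral_condExp (F.le n), integral_add' (hfi n) ((hDi n).const_mul _),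
      integral_const_mul] at this
    linarith
  have hfu : ∀ n, ∫ ω, f n ω ∂μ ≤ 4 * T := fun n => by
    calc ∫ ω, f n ω ∂μ ≤ ∫ _ω, 4 * T ∂μ := integral_mono (hfi n) (integrable_const _) fun ω => by
          have := hST n; have := sq_nonneg (D n ω); simp only [hf]; linarith
      _ = 4 * T := by simp
  have hsum : ∀ n, ∫ ω, f 0 ω ∂μ + 2 * (1 - ρ * β) *
      ∑ k ∈ Finset.range n, (r k * ∫ ω, (D k ω)^2 ∂μ) ≤ ∫ ω, f n ω ∂μ := by
    intro n
    induction n with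
    | zero => simp
    | succ n ih => rw [Finset.sum_range_succ, mul_add]; linarith [hstep n]
  have hsummable : Summable fun k => r k * ∫ ω, (D k ω)^2 ∂μ := by
    refine summable_of_sum_range_le (c := (4 * T - ∫ ω, f 0 ω ∂μ) / (2 * (1 - ρ * β)))
      (fun n => mul_nonneg (hr n).1 (hx0 n)) fun n => ?_
    rw [le_div_iff₀ (by linarith)]
    linarith [hsum n, hfu n]
  have hzero : ∫ ω, L ω ∂μ = 0 := by
    by_contra hne
    have hpos : 0 < ∫ ω, L ω ∂μ := lt_of_le_of_ne (integral_nonneg_of_ae hL0) (Ne.symm hne)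
    apply hrdiv
    have hev := hint.eventually (lt_mem_nhds (half_lt_self hpos))
    obtain ⟨n0, hn0⟩ := eventually_atTop.1 hev
    rw [← summable_nat_add_iff n0]
    have hs := ((summable_nat_add_iff n0).2 hsummable).mul_right ((∫ ω, L ω ∂μ) / 2)⁻¹
    refine Summable.of_nonneg_of_le (fun n => (hr _).1) (fun n => ?_) hs
    rw [← div_eq_mul_inv, le_div_iff₀ (by linarith)]
    exact mul_le_mul_of_nonneg_left (hn0 _ (by omega)).le (hr _).1
  have hLz := (integral_eq_zero_iff_of_nonneg_ae hL0 hLi).1 hzero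
  filter_upwards [hDL, hLz] with ω h h0
  rw [h0, Pi.zero_apply] at h
  rw [tendsto_zero_iff_abs_tendsto_zero]
  have := (Real.continuous_sqrt.tendsto 0).comp h
  simpa [Function.comp_def, Real.sqrt_sq_eq_abs] using this

/-- **Theorem (synchronization)**: if `Σ r_n = +∞`, `Σ r_n² < +∞` and `ρ(1-α) < 1`,
then `Z_n(i) - Z_n → 0` a.s. for all `i`; in particular if `Z_n → Z` a.s. then
`Z_n(i) → Z` a.s. for all `i`. (No assumption on the initial configuration is needed.) -/
theorem stmt_5
    {Ω : Type*} [MeasurableSpace Ω] (μ : Measure Ω) [IsProbabilityMeasure μ]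
    (N : ℕ) (hN : 1 ≤ N)
    (ρ α q : ℝ)
    (hρ : ρ ∈ Set.Icc (0:ℝ) 1) (hα : α ∈ Set.Icc (0:ℝ) 1) (hq : q ∈ Set.Icc (0:ℝ) 1)
    (r : ℕ → ℝ) (hr : ∀ n, 0 ≤ r n ∧ r n < 1)
    (Z : ℕ → Fin N → Ω → ℝ) (I : ℕ → Fin N → Ω → ℝ)
    (hZmeas : ∀ n i, Measurable (Z n i))
    (hImeas : ∀ n i, Measurable (I n i))
    (hZ01 : ∀ n i ω, Z n i ω ∈ Set.Icc (0:ℝ) 1)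
    (hI01 : ∀ n i ω, I n i ω = 0 ∨ I n i ω = 1)
    -- dynamics: `Z_{n+1}(i) = (1 - r_n) Z_n(i) + r_n (ρ I_{n+1}(i) + (1-ρ) q)`
    -- (here `I n i` stands for `I_{n+1}(i)`)
    (hdyn : ∀ n i ω, Z (n + 1) i ω
      = (1 - r n) * Z n i ω + r n * (ρ * I n i ω + (1 - ρ) * q))
    -- conditional independence of `I_{n+1}(1), …, I_{n+1}(N)` given `F_n`, together with
    -- the conditional law `P(I_{n+1}(i) = 1 | F_n) = (1-α) Z_n(i) + α Z_n`, expressed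
    -- (equivalently, for {0,1}-valued variables) through conditional product moments
    (hcond : ∀ n (s : Finset (Fin N)),
      μ[(fun ω => ∏ i ∈ s, I n i ω) | walkFiltration Z n]
        =ᵐ[μ] fun ω => ∏ i ∈ s, ((1 - α) * Z n i ω + α * walkMean Z n ω))
    (hρα : ρ * (1 - α) < 1) (hrdiv : ¬ Summable r) (hrsq : Summable (fun n => (r n) ^ 2)) :
    (∀ i : Fin N, ∀ᵐ ω ∂μ, Tendsto (fun n => Z n i ω - walkMean Z n ω) atTop (nhds 0))
    ∧ ∀ Zlim : Ω → ℝ,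
        (∀ᵐ ω ∂μ, Tendsto (fun n => walkMean Z n ω) atTop (nhds (Zlim ω))) →
        ∀ i : Fin N, ∀ᵐ ω ∂μ, Tendsto (fun n => Z n i ω) atTop (nhds (Zlim ω)) := by
  have hN' : (0:ℝ) < N := by exact_mod_cast hN
  have hI : ∀ n i ω, I n i ω ∈ Set.Icc (0:ℝ) 1 := fun n i ω => by
    rcases hI01 n i ω with h | h <;> simp [h]
  have main : ∀ i : Fin N, ∀ᵐ ω ∂μ,
      Tendsto (fun n => Z n i ω - walkMean Z n ω) atTop (nhds 0) := by
    intro i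
    have hIi : ∀ n j, Integrable (I n j) μ := fun n j =>
      Integrable.of_bound (hImeas n j).aestronglyMeasurable 1 (ae_of_all _ fun ω => by
        rw [Real.norm_eq_abs, abs_of_nonneg (hI n j ω).1]; exact (hI n j ω).2)
    refine core μ (walkFilt Z hZmeas) (fun n ω => Z n i ω - walkMean Z n ω)
      (fun n ω => I n i ω - (∑ j, I n j ω) / N) ρ (1 - α) hρ hρα r hr ?_ ?_ ?_ ?_ ?_ ?_ hrdiv hrsq
    · intro n
      refine (walk_meas Z n i).sub (Measurable.div_const ?_ _)
      exact Finset.measurable_fun_sum _ fun j _ => walk_meas Z n j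
    · intro n
      exact (hImeas n i).sub ((Finset.measurable_fun_sum _ fun j _ => hImeas n j).div_const _)
    · intro n ω
      have h1 := hZ01 n i ω
      have h2 := mean_mem hN (fun j => Z n j ω) (fun j => hZ01 n j ω)
      rw [abs_le]; unfold walkMean
      constructor <;> linarith [h1.1, h1.2, h2.1, h2.2]
    · intro n ω
      have h1 := hI n i ω
      have h2 := mean_mem hN (fun j => I n j ω) (fun j => hI n j ω)
      rw [abs_le]
      constructor <;> linarith [h1.1, h1.2, h2.1, h2.2]
    · intro n ω
      simp only [walkMean, hdyn, Finset.sum_add_distrib, ← Finset.mul_sum, Finset.sum_const,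
        Finset.card_univ, Fintype.card_fin, nsmul_eq_mul]
      field_simp
      ring
    · intro n
      have hc : ∀ j, μ[I n j | walkFiltration Z n]
          =ᵐ[μ] fun ω => (1 - α) * Z n j ω + α * walkMean Z n ω := fun j => by
        simpa using hcond n {j}
      have e : (fun ω => I n i ω - (∑ j, I n j ω) / N)
          = I n i - (N:ℝ)⁻¹ • ∑ j, I n j := by
        ext ω; simp [Finset.sum_apply, div_eq_inv_mul]
      change μ[fun ω => I n i ω - (∑ j, I n j ω) / N | walkFiltration Z n] =ᵐ[μ] _
      rw [e]
      have hsi : Integrable (∑ j, I n j) μ := integrable_finset_sum' _ fun j _ => hIi n j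
      have h1 := condExp_sub (hIi n i) (hsi.smul (N:ℝ)⁻¹) (walkFiltration Z n)
      have h2 := condExp_smul (μ := μ) (N:ℝ)⁻¹ (∑ j, I n j) (walkFiltration Z n)
      have h3 := condExp_finsetSum (μ := μ) (s := Finset.univ) (f := fun j => I n j)
        (fun j _ => hIi n j) (walkFiltration Z n)
      filter_upwards [h1, h2, h3, ae_all_iff.2 hc] with ω h1 h2 h3 h4
      rw [h1, Pi.sub_apply, h2, Pi.smul_apply, h3, Finset.sum_apply, h4 i,
        Finset.sum_congr rfl fun j _ => h4 j]
      simp only [walkMean, Finset.sum_add_distrib, ← Finset.mul_sum, Finset.sum_const,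
        Finset.card_univ, Fintype.card_fin, nsmul_eq_mul, smul_eq_mul]
      field_simp
      ring
  refine ⟨main, fun Zlim hlim i => ?_⟩
  filter_upwards [main i, hlim] with ω h1 h2
  simpa using h1.add h2
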